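/- arXiv:1701.04596 — 6 statements merged into one kernel-verified Lean document; each statement's English description precedes it below -/
import Mathlib

section
/- Let c > 0 and α > 2 be real, let κ be the unique positive real number with (1 − 2κ/α)e^κ = 1, and define h(τ) = (τ − 2c/α)·e^{c/τ} − τ for τ > 0. Then h(τ) < 0 for 0 < τ < c/κ, h(c/κ) = 0, and h(τ) > 0 for τ > c/κ. -/
open Real

/-- The secant slope `(1 - e^{-x}) / x` of `x ↦ 1 - e^{-x}` at the origin is strictly decreasing
on the positive reals. -/
lemma mul_one_sub_exp_neg_lt {x y : ℝ} (hx : 0 < x) (hxy : x < y) :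
    x * (1 - Real.exp (-y)) < y * (1 - Real.exp (-x)) := by
  have hy : 0 < y := hx.trans hxy
  have hconv := strictConvexOn_exp.2 (Set.mem_univ 0) (Set.mem_univ (-y)) (by linarith)
    (sub_pos.2 ((div_lt_one hy).2 hxy)) (div_pos hx hy) (by ring)
  have hpoint : (1 - x / y) • (0 : ℝ) + (x / y) • (-y) = -x := by
    simp only [smul_eq_mul]
    field_simp
    ring
  rw [hpoint, Real.exp_zero] at hconv
  simp only [smul_eq_mul] at hconv
  have hscaled := mul_lt_mul_of_pos_left hconv hy
  have hexpand : y * ((1 - x / y) * 1 + x / y * Real.exp (-y)) = y - x + x * Real.exp (-y) := by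
    field_simp
  linarith

/-- Factorisation of `h` in the variable `c / τ`. -/
lemma sub_mul_exp_sub_eq (c α : ℝ) {τ : ℝ} (hτ : τ ≠ 0) :
    (τ - 2 * c / α) * Real.exp (c / τ) - τ =
      τ * Real.exp (c / τ) * ((1 - Real.exp (-(c / τ))) - 2 / α * (c / τ)) := by
  have hexp : Real.exp (c / τ) * Real.exp (-(c / τ)) = 1 := by
    rw [← Real.exp_add, add_neg_cancel, Real.exp_zero]
  have hcancel : τ * (c / τ) = c := mul_div_cancel₀ c hτ
  linear_combination τ * hexp + 2 / α * Real.exp (c / τ) * hcancel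

/-- With `c > 0`, `α > 2`, `κ` the unique positive root of `(1 − 2κ/α)e^κ = 1`, and
`h(τ) = (τ − 2c/α)e^{c/τ} − τ`, the function `h` is negative on `(0, c/κ)`,
vanishes at `c/κ`, and is positive on `(c/κ, ∞)`. -/
theorem sign_of_h (c α κ : ℝ) (hc : 0 < c) (hα : 2 < α) (hκ : 0 < κ)
    (hκeq : (1 - 2 * κ / α) * Real.exp κ = 1) :
    (∀ τ : ℝ, 0 < τ → τ < c / κ → (τ - 2 * c / α) * Real.exp (c / τ) - τ < 0) ∧
    ((c / κ - 2 * c / α) * Real.exp (c / (c / κ)) - c / κ = 0) ∧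
    (∀ τ : ℝ, c / κ < τ → 0 < (τ - 2 * c / α) * Real.exp (c / τ) - τ) := by
  have hroot : 1 - Real.exp (-κ) = 2 / α * κ := by
    rw [Real.exp_neg, ← eq_inv_of_mul_eq_one_left hκeq]
    ring
  refine ⟨fun τ hτ hlt => ?_, ?_, fun τ hlt => ?_⟩
  · have hκx : κ < c / τ := (lt_div_comm₀ hτ hκ).1 hlt
    have hslope := mul_one_sub_exp_neg_lt hκ hκx
    rw [hroot] at hslope
    rw [sub_mul_exp_sub_eq c α hτ.ne']
    refine mul_neg_of_pos_of_neg (by positivity) (sub_neg.2 (lt_of_mul_lt_mul_left ?_ hκ.le))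
    linarith
  · rw [sub_mul_exp_sub_eq c α (div_pos hc hκ).ne', div_div_cancel₀ hc.ne', hroot]
    ring
  · have hτ : 0 < τ := (div_pos hc hκ).trans hlt
    have hxκ : c / τ < κ := (div_lt_comm₀ hκ hτ).1 hlt
    have hslope := mul_one_sub_exp_neg_lt (div_pos hc hτ) hxκ
    rw [hroot] at hslope
    rw [sub_mul_exp_sub_eq c α hτ.ne']
    refine mul_pos (by positivity) (sub_pos.2 (lt_of_mul_lt_mul_left ?_ hκ.le))
    linarith
end

section
/- Let c > 0 and α > 2 be real, let κ be the unique positive real number with (1 − 2κ/α)e^κ = 1, and define φ(τ) = τ·(e^{c/τ} − 1)^{2/α} for τ > 0. Then φ is strictly decreasing on (0, c/κ] and strictly increasing on [c/κ, ∞); in particular τ₀ = c/κ is the unique global minimizer of φ on (0, ∞). -/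
open Real Set

/-- The secant line of `x ↦ exp (-x)` through `0` and `κ` lies above the graph inside `(0, κ)`. -/
lemma exp_neg_lt_secant {b κ x : ℝ} (hκ : exp (-κ) = 1 - b * κ) (hx : 0 < x) (hxκ : x < κ) :
    exp (-x) < 1 - b * x := by
  have hκ0 : 0 < κ := hx.trans hxκ
  have h := strictConvexOn_exp.2 (mem_univ (-κ)) (mem_univ 0) (by linarith)
    (div_pos hx hκ0) (sub_pos.2 ((div_lt_one hκ0).2 hxκ)) (by ring : x / κ + (1 - x / κ) = 1)
  simp only [smul_eq_mul, exp_zero, hκ] at h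
  have e₁ : x / κ * -κ + (1 - x / κ) * 0 = -x := by field_simp; ring
  have e₂ : x / κ * (1 - b * κ) + (1 - x / κ) * 1 = 1 - b * x := by field_simp; ring
  rwa [e₁, e₂] at h

/-- The secant line of `x ↦ exp (-x)` through `0` and `κ` lies below the graph beyond `κ`. -/
lemma secant_lt_exp_neg {b κ x : ℝ} (hκ : exp (-κ) = 1 - b * κ) (hκ0 : 0 < κ) (hxκ : κ < x) :
    1 - b * x < exp (-x) := by
  have hx : 0 < x := hκ0.trans hxκ
  by_contra! hle
  have h := exp_neg_lt_secant (b := (1 - exp (-x)) / x) (κ := x) (by field_simp; ring) hκ0 hxκ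
  have hb : b ≤ (1 - exp (-x)) / x := by rw [le_div_iff₀ hx]; linarith
  nlinarith

lemma hasDerivAt_mul_log_exp_sub_one_sub_log (b : ℝ) {x : ℝ} (hx : 0 < x) :
    HasDerivAt (fun y => b * log (exp y - 1) - log y) (b * (exp x / (exp x - 1)) - x⁻¹) x := by
  have h : exp x - 1 ≠ 0 := (sub_pos.2 (one_lt_exp_iff.2 hx)).ne'
  exact ((((hasDerivAt_exp x).sub_const 1).log h).const_mul b).sub (hasDerivAt_log hx.ne')

lemma mul_exp_div_exp_sub_one_sub_inv (b : ℝ) {x : ℝ} (hx : 0 < x) :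
    b * (exp x / (exp x - 1)) - x⁻¹ =
      exp x / ((exp x - 1) * x) * (exp (-x) - (1 - b * x)) := by
  have h : exp x - 1 ≠ 0 := (sub_pos.2 (one_lt_exp_iff.2 hx)).ne'
  rw [exp_neg]
  field_simp
  ring

lemma continuousOn_mul_log_exp_sub_one_sub_log (b : ℝ) :
    ContinuousOn (fun y => b * log (exp y - 1) - log y) (Ioi 0) := fun _ hx =>
  (hasDerivAt_mul_log_exp_sub_one_sub_log b hx).continuousAt.continuousWithinAt

lemma exp_div_exp_sub_one_mul_pos {x : ℝ} (hx : 0 < x) : 0 < exp x / ((exp x - 1) * x) :=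
  div_pos (exp_pos x) (mul_pos (sub_pos.2 (one_lt_exp_iff.2 hx)) hx)

lemma strictAntiOn_mul_log_exp_sub_one_sub_log {b κ : ℝ} (hκ : exp (-κ) = 1 - b * κ) :
    StrictAntiOn (fun y => b * log (exp y - 1) - log y) (Ioc 0 κ) := by
  refine strictAntiOn_of_deriv_neg (convex_Ioc 0 κ)
    ((continuousOn_mul_log_exp_sub_one_sub_log b).mono fun x hx => hx.1) fun x hx => ?_
  rw [interior_Ioc] at hx
  rw [(hasDerivAt_mul_log_exp_sub_one_sub_log b hx.1).deriv,
    mul_exp_div_exp_sub_one_sub_inv b hx.1]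
  exact mul_neg_of_pos_of_neg (exp_div_exp_sub_one_mul_pos hx.1)
    (sub_neg.2 (exp_neg_lt_secant hκ hx.1 hx.2))

lemma strictMonoOn_mul_log_exp_sub_one_sub_log {b κ : ℝ} (hκ : exp (-κ) = 1 - b * κ)
    (hκ0 : 0 < κ) : StrictMonoOn (fun y => b * log (exp y - 1) - log y) (Ici κ) := by
  refine strictMonoOn_of_deriv_pos (convex_Ici κ)
    ((continuousOn_mul_log_exp_sub_one_sub_log b).mono fun x hx => hκ0.trans_le hx) fun x hx => ?_
  rw [interior_Ici] at hx
  have hx0 : 0 < x := hκ0.trans hx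
  rw [(hasDerivAt_mul_log_exp_sub_one_sub_log b hx0).deriv,
    mul_exp_div_exp_sub_one_sub_inv b hx0]
  exact mul_pos (exp_div_exp_sub_one_mul_pos hx0) (sub_pos.2 (secant_lt_exp_neg hκ hκ0 hx))

lemma mul_exp_div_sub_one_rpow_eq {c τ : ℝ} (b : ℝ) (hc : 0 < c) (hτ : 0 < τ) :
    τ * (exp (c / τ) - 1) ^ b = c * exp (b * log (exp (c / τ) - 1) - log (c / τ)) := by
  have hx : 0 < c / τ := div_pos hc hτ
  rw [exp_sub, exp_log hx, rpow_def_of_pos (sub_pos.2 (one_lt_exp_iff.2 hx)), mul_comm b]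
  field_simp

/-- For `c > 0`, `α > 2` and `κ` the unique positive root of `(1 − 2κ/α)e^κ = 1`, the function
`φ(τ) = τ·(e^{c/τ} − 1)^{2/α}` is strictly decreasing on `(0, c/κ]` and strictly increasing on
`[c/κ, ∞)`; in particular `τ₀ = c/κ` is the unique global minimizer of `φ` on `(0, ∞)`. -/
theorem phi_min_at_c_div_kappa (c α κ : ℝ) (hc : 0 < c) (hα : 2 < α) (hκ : 0 < κ)
    (hκeq : (1 - 2 * κ / α) * Real.exp κ = 1) :
    StrictAntiOn (fun τ : ℝ => τ * (Real.exp (c / τ) - 1) ^ (2 / α)) (Ioc 0 (c / κ)) ∧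
    StrictMonoOn (fun τ : ℝ => τ * (Real.exp (c / τ) - 1) ^ (2 / α)) (Ici (c / κ)) ∧
    (∀ τ : ℝ, 0 < τ → τ ≠ c / κ →
      (c / κ) * (Real.exp (c / (c / κ)) - 1) ^ (2 / α)
        < τ * (Real.exp (c / τ) - 1) ^ (2 / α)) := by
  have hκ' : exp (-κ) = 1 - 2 / α * κ := by
    rw [exp_neg, ← eq_inv_of_mul_eq_one_left hκeq]
    ring
  have hanti : StrictAntiOn (fun τ : ℝ => τ * (Real.exp (c / τ) - 1) ^ (2 / α))
      (Ioc 0 (c / κ)) := by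
    intro s hs t ht hst
    simp only [mul_exp_div_sub_one_rpow_eq _ hc hs.1, mul_exp_div_sub_one_rpow_eq _ hc ht.1]
    gcongr c * exp ?_
    exact strictMonoOn_mul_log_exp_sub_one_sub_log hκ' hκ
      ((le_div_comm₀ ht.1 hκ).1 ht.2) ((le_div_comm₀ hs.1 hκ).1 hs.2)
      (div_lt_div_of_pos_left hc hs.1 hst)
  have hmono : StrictMonoOn (fun τ : ℝ => τ * (Real.exp (c / τ) - 1) ^ (2 / α))
      (Ici (c / κ)) := by
    intro s hs t ht hst
    have hs0 : 0 < s := (div_pos hc hκ).trans_le hs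
    have ht0 : 0 < t := hs0.trans hst
    simp only [mul_exp_div_sub_one_rpow_eq _ hc hs0, mul_exp_div_sub_one_rpow_eq _ hc ht0]
    gcongr c * exp ?_
    exact strictAntiOn_mul_log_exp_sub_one_sub_log hκ'
      ⟨div_pos hc ht0, (div_le_comm₀ hκ ht0).1 ht⟩ ⟨div_pos hc hs0, (div_le_comm₀ hκ hs0).1 hs⟩
      (div_lt_div_of_pos_left hc hs0 hst)
  refine ⟨hanti, hmono, fun τ hτ hne => ?_⟩
  rcases hne.lt_or_gt with h | h
  · exact hanti ⟨hτ, h.le⟩ ⟨div_pos hc hκ, le_rfl⟩ h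
  · exact hmono self_mem_Ici h.le h
end

section
/- Let ε > 0, let N be a positive integer, let q : {1,…,N} → ℝ with qᵢ ≥ 0 for all i, and define F(c) = Σᵢ qᵢ (cᵢ + (1−cᵢ)cᵢ/(cᵢ+ε)) for c ∈ ℝ^N. Then F is concave on the box [0,1]^N. -/
open Real Set Finset

theorem add_one_sub_mul_div_add_eq {ε x : ℝ} (hx : x + ε ≠ 0) :
    x + (1 - x) * x / (x + ε) = (1 + ε) - (1 + ε) * ε * (x + ε)⁻¹ := by
  field_simp
  ring

theorem concaveOn_add_one_sub_mul_div_add {ε : ℝ} (hε : 0 < ε) :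
    ConcaveOn ℝ (Set.Ici (0 : ℝ)) (fun x => x + (1 - x) * x / (x + ε)) := by
  refine ⟨convex_Ici 0, fun x hx y hy a b ha hb hab => ?_⟩
  simp only [Set.mem_Ici, smul_eq_mul] at *
  have hu : 0 < x + ε := by linarith
  have hv : 0 < y + ε := by linarith
  have hw : a * x + b * y + ε = a * (x + ε) + b * (y + ε) := by
    linear_combination -ε * hab
  have hw' : 0 < a * x + b * y + ε := by positivity
  have key : (a * x + b * y + ε)⁻¹ ≤ a * (x + ε)⁻¹ + b * (y + ε)⁻¹ := by
    have h := (convexOn_zpow (𝕜 := ℝ) (-1)).2 hu hv ha hb hab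
    simpa only [zpow_neg_one, smul_eq_mul, hw] using h
  rw [add_one_sub_mul_div_add_eq hu.ne', add_one_sub_mul_div_add_eq hv.ne',
    add_one_sub_mul_div_add_eq hw'.ne']
  have hmul := mul_le_mul_of_nonneg_left key (by positivity : 0 ≤ (1 + ε) * ε)
  linear_combination hmul + (1 + ε) * hab

/-- For `ε > 0`, `N` a positive integer and nonnegative weights `q`, the function
`F(c) = Σᵢ qᵢ (cᵢ + (1−cᵢ)cᵢ/(cᵢ+ε))` is concave on the box `[0,1]^N`. -/
theorem offloading_sum_concaveOn (ε : ℝ) (hε : 0 < ε) (N : ℕ) (hN : 0 < N)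
    (q : Fin N → ℝ) (hq : ∀ i, 0 ≤ q i) :
    ConcaveOn ℝ (Set.univ.pi fun _ : Fin N => Icc (0:ℝ) 1)
      (fun c : Fin N → ℝ => ∑ i, q i * (c i + (1 - c i) * c i / (c i + ε))) := by
  refine ⟨convex_pi fun _ _ => convex_Icc 0 1, fun c hc d hd a b ha hb hab => ?_⟩
  simp only [smul_eq_mul, Finset.mul_sum, ← Finset.sum_add_distrib]
  refine Finset.sum_le_sum fun i _ => ?_
  have h := (concaveOn_add_one_sub_mul_div_add hε).2 (hc i (Set.mem_univ i)).1
    (hd i (Set.mem_univ i)).1 ha hb hab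
  have hmul := mul_le_mul_of_nonneg_left h (hq i)
  simp only [Pi.add_apply, Pi.smul_apply, smul_eq_mul] at hmul ⊢
  linear_combination hmul
end

section
/- Let ε > 0, let N be a positive integer, let q : {1,…,N} → ℝ with qᵢ > 0 for all i, and define F(c) = Σᵢ qᵢ (cᵢ + (1−cᵢ)cᵢ/(cᵢ+ε)). Suppose u > 0 and c* ∈ ℝ^N is given by c*ᵢ = min( max( √(qᵢ ε(ε+1)/u) − ε, 0), 1) for each i, and that Σᵢ c*ᵢ = 1. Then for every c ∈ ℝ^N with 0 ≤ cᵢ ≤ 1 for all i and Σᵢ cᵢ = 1, we have F(c) ≤ F(c*). -/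
open Real Set Finset

/-- The cached-file reward has the closed form `(1 + ε) x / (x + ε)`. -/
theorem add_one_sub_mul_div_eq {ε x : ℝ} (h : x + ε ≠ 0) :
    x + (1 - x) * x / (x + ε) = (1 + ε) * x / (x + ε) := by
  field_simp
  ring

/-- Variational inequality for the truncation `s` of `r - ε` to the unit interval. -/
theorem sub_mul_sq_sub_mul_nonpos {ε r s x : ℝ} (hε : 0 < ε) (hr : 0 ≤ r)
    (hs : s = min (max (r - ε) 0) 1) (hx₀ : 0 ≤ x) (hx₁ : x ≤ 1) :
    (x - s) * (r ^ 2 - (x + ε) * (s + ε)) ≤ 0 := by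
  rcases le_total (r - ε) 0 with h | h
  · have hs₀ : s = 0 := by simp [hs, h]
    subst hs₀
    exact mul_nonpos_of_nonneg_of_nonpos (by linarith) (by nlinarith)
  · rcases le_total (r - ε) 1 with h' | h'
    · have hs' : s = r - ε := by simp [hs, h, h']
      subst hs'
      nlinarith [mul_nonneg hr (sq_nonneg (x - (r - ε)))]
    · have hs₁ : s = 1 := by simp [hs, h, h']
      subst hs₁
      exact mul_nonpos_of_nonpos_of_nonneg (by linarith) (by nlinarith)

/-- The reward lies below its supporting line of slope `u`, the Lagrange multiplier, at the
water-filling point. -/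
theorem reward_sub_le_mul_sub {ε q u s x : ℝ} (hε : 0 < ε) (hq : 0 < q) (hu : 0 < u)
    (hs : s = min (max (√(q * ε * (ε + 1) / u) - ε) 0) 1) (hx₀ : 0 ≤ x) (hx₁ : x ≤ 1) :
    q * (x + (1 - x) * x / (x + ε)) - q * (s + (1 - s) * s / (s + ε)) ≤ u * (x - s) := by
  have hs₀ : 0 ≤ s := hs ▸ le_min (le_max_right _ _) zero_le_one
  have hxε : 0 < x + ε := by linarith
  have hsε : 0 < s + ε := by linarith
  have key := sub_mul_sq_sub_mul_nonpos hε (sqrt_nonneg _) hs hx₀ hx₁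
  rw [sq_sqrt (by positivity)] at key
  have hdiff : q * (x + (1 - x) * x / (x + ε)) - q * (s + (1 - s) * s / (s + ε)) - u * (x - s) =
      u * ((x - s) * (q * ε * (ε + 1) / u - (x + ε) * (s + ε))) / ((x + ε) * (s + ε)) := by
    rw [add_one_sub_mul_div_eq hxε.ne', add_one_sub_mul_div_eq hsε.ne']
    field_simp
    ring
  rw [← sub_nonpos, hdiff]
  exact div_nonpos_of_nonpos_of_nonneg (mul_nonpos_of_nonneg_of_nonpos hu.le key) (by positivity)

/-- Optimality of the truncated water-filling caching distribution (Proposition 3):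
with `ε > 0`, positive weights `q`, `u > 0`, and
`c*ᵢ = min(max(√(qᵢ ε(ε+1)/u) − ε, 0), 1)` satisfying `Σᵢ c*ᵢ = 1`, the vector `c*`
maximizes `F(c) = Σᵢ qᵢ (cᵢ + (1−cᵢ)cᵢ/(cᵢ+ε))` over the simplex-with-box constraints. -/
theorem waterfilling_optimal (ε : ℝ) (hε : 0 < ε) (N : ℕ) (hN : 0 < N)
    (q : Fin N → ℝ) (hq : ∀ i, 0 < q i) (u : ℝ) (hu : 0 < u)
    (cstar : Fin N → ℝ)
    (hcstar : ∀ i, cstar i = min (max (Real.sqrt (q i * ε * (ε + 1) / u) - ε) 0) 1)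
    (hsum : ∑ i, cstar i = 1) :
    ∀ c : Fin N → ℝ, (∀ i, 0 ≤ c i ∧ c i ≤ 1) → ∑ i, c i = 1 →
      ∑ i, q i * (c i + (1 - c i) * c i / (c i + ε))
        ≤ ∑ i, q i * (cstar i + (1 - cstar i) * cstar i / (cstar i + ε)) := by
  intro c hc hcsum
  rw [← sub_nonpos, ← sum_sub_distrib]
  calc _ ≤ ∑ i, u * (c i - cstar i) := sum_le_sum fun i _ =>
        reward_sub_le_mul_sub hε (hq i) hu (hcstar i) (hc i).1 (hc i).2
    _ = 0 := by rw [← mul_sum, sum_sub_distrib, hcsum, hsum, sub_self, mul_zero]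
end

section
/- Let β > 0 and ε > 0 be real, let N_f and N* be positive integers with N* < N_f, set S = Σ_{j=1}^{N*} j^{−β/2}, and define c*ᵢ = max( i^{−β/2}(N*ε + 1)/S − ε, 0) for i ∈ {1,…,N_f}. If (N*)^{−β/2}(N*ε + 1)/S > ε and (N*+1)^{−β/2}(N*ε + 1)/S ≤ ε, then c*ᵢ > 0 for all i ≤ N*, c*ᵢ = 0 for all i with N* < i ≤ N_f, c* is nonincreasing in i, and Σ_{i=1}^{N_f} c*ᵢ = 1. -/
open Real Finset

/-- Structure of the closed-form caching probabilities of Proposition 3 for a Zipf popularity: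
with `S = Σ_{j=1}^{N*} j^{−β/2}` and `c*ᵢ = max(i^{−β/2}(N*ε+1)/S − ε, 0)`, if the two
threshold inequalities hold then `c*` is positive exactly on `{1,…,N*}`, is nonincreasing,
and sums to one over `{1,…,N_f}`. -/
theorem zipf_caching_structure (β ε : ℝ) (hβ : 0 < β) (hε : 0 < ε)
    (Nf Nstar : ℕ) (hNf : 0 < Nf) (hNstar : 0 < Nstar) (hlt : Nstar < Nf)
    (S : ℝ) (hS : S = ∑ j ∈ Finset.Icc 1 Nstar, (j : ℝ) ^ (-(β / 2)))
    (cstar : ℕ → ℝ)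
    (hcstar : ∀ i : ℕ, cstar i
      = max ((i : ℝ) ^ (-(β / 2)) * ((Nstar : ℝ) * ε + 1) / S - ε) 0)
    (hthr1 : (Nstar : ℝ) ^ (-(β / 2)) * ((Nstar : ℝ) * ε + 1) / S > ε)
    (hthr2 : ((Nstar : ℝ) + 1) ^ (-(β / 2)) * ((Nstar : ℝ) * ε + 1) / S ≤ ε) :
    (∀ i : ℕ, 1 ≤ i → i ≤ Nstar → 0 < cstar i) ∧
    (∀ i : ℕ, Nstar < i → i ≤ Nf → cstar i = 0) ∧
    (∀ i j : ℕ, 1 ≤ i → i ≤ j → j ≤ Nf → cstar j ≤ cstar i) ∧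
    (∑ i ∈ Finset.Icc 1 Nf, cstar i = 1) := by
  have hSpos : 0 < S := by
    rw [hS]
    refine Finset.sum_pos (fun j hj => ?_) ⟨1, Finset.mem_Icc.2 ⟨le_rfl, hNstar⟩⟩
    have : 0 < j := (Finset.mem_Icc.1 hj).1
    positivity
  have hanti : ∀ i j : ℕ, 1 ≤ i → i ≤ j →
      (j : ℝ) ^ (-(β / 2)) * ((Nstar : ℝ) * ε + 1) / S
        ≤ (i : ℝ) ^ (-(β / 2)) * ((Nstar : ℝ) * ε + 1) / S := by
    intro i j hi hij
    have hi' : (0 : ℝ) < i := by exact_mod_cast hi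
    have hpow : (j : ℝ) ^ (-(β / 2)) ≤ (i : ℝ) ^ (-(β / 2)) :=
      Real.rpow_le_rpow_of_nonpos hi' (by exact_mod_cast hij) (by linarith)
    gcongr
  have hpos : ∀ i : ℕ, 1 ≤ i → i ≤ Nstar →
      0 < (i : ℝ) ^ (-(β / 2)) * ((Nstar : ℝ) * ε + 1) / S - ε := by
    intro i hi hiN
    linarith [hanti i Nstar hi hiN]
  have hzero : ∀ i : ℕ, Nstar < i → cstar i = 0 := by
    intro i hi
    have h := hanti (Nstar + 1) i (by omega) hi
    push_cast at h
    rw [hcstar, max_eq_right (by linarith)]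
  refine ⟨fun i hi hiN => ?_, fun i hi _ => hzero i hi, fun i j hi hij _ => ?_, ?_⟩
  · rw [hcstar]
    exact lt_max_of_lt_left (hpos i hi hiN)
  · rw [hcstar, hcstar]
    exact max_le_max (sub_le_sub_right (hanti i j hi hij) ε) le_rfl
  · have hsub : Finset.Icc 1 Nstar ⊆ Finset.Icc 1 Nf := Finset.Icc_subset_Icc_right hlt.le
    rw [← Finset.sum_subset hsub fun i hi hi' => hzero i (by
      simp only [Finset.mem_Icc] at hi hi'
      omega)]
    calc ∑ i ∈ Finset.Icc 1 Nstar, cstar i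
        = ∑ i ∈ Finset.Icc 1 Nstar,
            ((i : ℝ) ^ (-(β / 2)) * ((Nstar : ℝ) * ε + 1) / S - ε) := by
          refine Finset.sum_congr rfl fun i hi => ?_
          obtain ⟨hi, hiN⟩ := Finset.mem_Icc.1 hi
          rw [hcstar, max_eq_left (hpos i hi hiN).le]
      _ = S * ((Nstar : ℝ) * ε + 1) / S - Nstar * ε := by
          rw [Finset.sum_sub_distrib, ← Finset.sum_div, ← Finset.sum_mul, ← hS]
          simp
      _ = 1 := by
          rw [mul_div_cancel_left₀ _ hSpos.ne']
          ring
end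

section
/- For every real a > 0, the function c ↦ c·(1 − (1 + a/(3.5 c))^{−3.5}) is concave on (0, ∞). -/
open Real Set

/-- Restricting the perspective `(x, c) ↦ c * g (x / c)` of a concave function `g` to a fixed
`x = a` gives a concave function of `c`. -/
theorem ConcaveOn.mul_comp_const_div {g : ℝ → ℝ} (hg : ConcaveOn ℝ (Ioi 0) g) {a : ℝ}
    (ha : 0 < a) : ConcaveOn ℝ (Ioi 0) (fun c : ℝ => c * g (a / c)) := by
  refine ⟨convex_Ioi 0, fun x hx y hy s t hs ht hst => ?_⟩
  have hC : 0 < s * x + t * y := convex_Ioi (0 : ℝ) hx hy hs ht hst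
  rw [mem_Ioi] at hx hy
  have key := hg.2 (div_pos ha hx) (div_pos ha hy)
    (div_nonneg (mul_nonneg hs hx.le) hC.le) (div_nonneg (mul_nonneg ht hy.le) hC.le)
    (by rw [← add_div, div_self hC.ne'])
  have harg : s * x / (s * x + t * y) * (a / x) + t * y / (s * x + t * y) * (a / y)
      = a / (s * x + t * y) := by
    field_simp
    exact hst
  simp only [smul_eq_mul] at key ⊢
  rw [harg] at key
  calc s * (x * g (a / x)) + t * (y * g (a / y))
      = (s * x + t * y) * (s * x / (s * x + t * y) * g (a / x)
          + t * y / (s * x + t * y) * g (a / y)) := by field_simp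
    _ ≤ _ := mul_le_mul_of_nonneg_left key hC.le

/-- Powers with nonpositive exponent are convex on the positive half-line. -/
theorem convexOn_rpow_neg_exponent {p : ℝ} (hp : 0 ≤ p) :
    ConvexOn ℝ (Ioi 0) (fun x : ℝ => x ^ (-p)) := by
  refine ⟨convex_Ioi 0, fun x hx y hy s t hs ht hst => ?_⟩
  have hz : 0 < s * x + t * y := convex_Ioi (0 : ℝ) hx hy hs ht hst
  have hlog := strictConcaveOn_log_Ioi.concaveOn.2 hx hy hs ht hst
  have hexp := convexOn_exp.2 (mem_univ (log x * -p)) (mem_univ (log y * -p)) hs ht hst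
  rw [mem_Ioi] at hx hy
  simp only [smul_eq_mul] at hlog hexp ⊢
  rw [rpow_def_of_pos hx, rpow_def_of_pos hy, rpow_def_of_pos hz]
  refine (exp_le_exp.2 ?_).trans hexp
  linarith [mul_le_mul_of_nonneg_left hlog hp]

/-- For every real `a > 0`, the function `c ↦ c·(1 − (1 + a/(3.5c))^{−3.5})` is concave
on `(0, ∞)`. -/
theorem transmit_prob_term_concave (a : ℝ) (ha : 0 < a) :
    ConcaveOn ℝ (Ioi (0:ℝ))
      (fun c : ℝ => c * (1 - (1 + a / (3.5 * c)) ^ (-(3.5:ℝ)))) := by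
  have hg : ConcaveOn ℝ (Ioi 0) (fun u : ℝ => 1 - (1 + u) ^ (-(3.5:ℝ))) := by
    refine (concaveOn_const 1 (convex_Ioi 0)).sub ?_
    refine ((convexOn_rpow_neg_exponent (p := 3.5) (by norm_num)).translate_right 1).subset
      (fun u hu => ?_) (convex_Ioi 0)
    rw [mem_Ioi] at hu
    exact add_pos one_pos hu
  have h := hg.mul_comp_const_div (a := a / 3.5) (by positivity)
  simpa only [div_div] using h
end
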